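/- If isBST t holds and k ∈ Dom t, then there exists a subtree s ∈ Subtrees t of the form node ls k ds rs (root key k) such that Map t k = some ds; i.e. the binary-search-tree search starting from the root finds a node whose stored data is the value of Map t at k. -/

import Mathlib

inductive BTree where
  | leaf : BTree
  | node : BTree → ℤ → ℤ → BTree → BTree
deriving DecidableEq

open BTree

def Dom : BTree → Set ℤ
  | leaf => ∅
  | node l k _ r => {k} ∪ Dom l ∪ Dom r

def isBST : BTree → Prop
  | leaf => True
  | node l k _ r => isBST l ∧ isBST r ∧ (∀ y ∈ Dom l, y < k) ∧ (∀ y ∈ Dom r, k < y)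

def Map : BTree → ℤ → Option ℤ
  | leaf, _ => none
  | node l k d r, x =>
      (Map r x).orElse fun _ =>
        (Map l x).orElse fun _ =>
          if x = k then some d else none

def Subtrees : BTree → Set BTree
  | leaf => ∅
  | node l k d r => {node l k d r} ∪ Subtrees l ∪ Subtrees r

theorem Map_eq_none_of_notMem_Dom {t : BTree} {x : ℤ} (h : x ∉ Dom t) : Map t x = none := by
  induction t with
  | leaf => rfl
  | node l k d r ihl ihr =>
    simp only [Dom, Set.mem_union, Set.mem_singleton_iff, not_or] at h
    simp [Map, ihl h.1.2, ihr h.2, h.1.1]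

theorem search_finds_map_value (t : BTree) (k : ℤ)
    (hbst : isBST t) (hk : k ∈ Dom t) :
    ∃ ls ds rs, node ls k ds rs ∈ Subtrees t ∧ Map t k = some ds := by
  induction t with
  | leaf => exact hk.elim
  | node l m d r ihl ihr =>
    obtain ⟨hl, hr, hlt, hgt⟩ := hbst
    rcases hk with (rfl | hk) | hk
    · have hkl : k ∉ Dom l := fun h => (hlt k h).false
      have hkr : k ∉ Dom r := fun h => (hgt k h).false
      exact ⟨l, d, r, Or.inl (Or.inl rfl), by
        simp [Map, Map_eq_none_of_notMem_Dom hkl, Map_eq_none_of_notMem_Dom hkr]⟩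
    · obtain ⟨ls, ds, rs, hs, hm⟩ := ihl hl hk
      have hkr : k ∉ Dom r := fun h => (hgt k h).not_gt (hlt k hk)
      exact ⟨ls, ds, rs, Or.inl (Or.inr hs), by
        simp [Map, Map_eq_none_of_notMem_Dom hkr, hm]⟩
    · obtain ⟨ls, ds, rs, hs, hm⟩ := ihr hr hk
      exact ⟨ls, ds, rs, Or.inr hs, by simp [Map, hm]⟩
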